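/- The number of unordered pairs {A, B} of distinct disjoint 4×4 S-permutation matrices (the case n = 2) is exactly 56. -/

import Mathlib

def IsSPerm (n : ℕ) (A : (Fin n × Fin n) → (Fin n × Fin n) → Fin 2) : Prop :=
  (∀ r : Fin n × Fin n, ∃! c : Fin n × Fin n, A r c = 1) ∧
  (∀ c : Fin n × Fin n, ∃! r : Fin n × Fin n, A r c = 1) ∧
  (∀ k l : Fin n, ∃! p : Fin n × Fin n, A (k, p.1) (l, p.2) = 1)

def DisjointS (n : ℕ) (A B : (Fin n × Fin n) → (Fin n × Fin n) → Fin 2) : Prop :=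
  ¬ ∃ r c : Fin n × Fin n, A r c = 1 ∧ B r c = 1

/-- Row offsets in the two block rows and column offsets in the two block columns. -/
abbrev SPermCode : Type := (Fin 2 → Fin 2) × (Fin 2 → Fin 2)

/-- The matrix whose unique `1` in block `(k, l)` is at `(x k + l, y l + k)`. -/
def SPermCode.toMatrix (p : SPermCode) (r c : Fin 2 × Fin 2) : Fin 2 :=
  if r.2 = p.1 r.1 + c.1 ∧ c.2 = p.2 c.1 + r.1 then 1 else 0

theorem SPermCode.toMatrix_eq_one_iff (p : SPermCode) (r c : Fin 2 × Fin 2) :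
    p.toMatrix r c = 1 ↔ r.2 = p.1 r.1 + c.1 ∧ c.2 = p.2 c.1 + r.1 := by
  simp [SPermCode.toMatrix]

theorem SPermCode.toMatrix_injective : Function.Injective SPermCode.toMatrix := by
  intro p q h
  have key (k l : Fin 2) : p.1 k = q.1 k ∧ p.2 l = q.2 l := by
    have h1 := (p.toMatrix_eq_one_iff (k, p.1 k + l) (l, p.2 l + k)).2 ⟨rfl, rfl⟩
    rw [h, SPermCode.toMatrix_eq_one_iff] at h1
    exact ⟨add_right_cancel h1.1, add_right_cancel h1.2⟩
  exact Prod.ext (funext fun k => (key k 0).1) (funext fun l => (key 0 l).2)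

theorem SPermCode.isSPerm_toMatrix (p : SPermCode) : IsSPerm 2 p.toMatrix := by
  simp only [IsSPerm, SPermCode.toMatrix_eq_one_iff]
  revert p
  unfold ExistsUnique
  decide +kernel

theorem IsSPerm.exists_toMatrix_eq {A : (Fin 2 × Fin 2) → (Fin 2 × Fin 2) → Fin 2}
    (hA : IsSPerm 2 A) : ∃ p : SPermCode, p.toMatrix = A := by
  obtain ⟨hrow, hcol, hblock⟩ := hA
  choose f hf hf' using hblock
  have hx (k : Fin 2) : (f k 0).1 ≠ (f k 1).1 := by
    intro h
    have h0 := hf k 0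
    simp only [h] at h0
    have := (hrow (k, (f k 1).1)).unique h0 (hf k 1)
    simp at this
  have hy (l : Fin 2) : (f 0 l).2 ≠ (f 1 l).2 := by
    intro h
    have h0 := hf 0 l
    simp only [h] at h0
    have := (hcol (l, (f 1 l).2)).unique h0 (hf 1 l)
    simp at this
  have succ_of_ne : ∀ a b : Fin 2, a ≠ b → b = a + 1 := by decide
  have eq_of_iff : ∀ a b : Fin 2, (a = 1 ↔ b = 1) → a = b := by decide
  have hfx (k l : Fin 2) : (f k l).1 = (f k 0).1 + l := by
    fin_cases l
    · simp
    · exact succ_of_ne _ _ (hx k)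
  have hfy (k l : Fin 2) : (f k l).2 = (f 0 l).2 + k := by
    fin_cases k
    · simp
    · exact succ_of_ne _ _ (hy l)
  refine ⟨(fun k => (f k 0).1, fun l => (f 0 l).2), ?_⟩
  ext1 ⟨k, i⟩
  ext1 ⟨l, j⟩
  apply eq_of_iff
  rw [SPermCode.toMatrix_eq_one_iff]
  dsimp only
  rw [← hfx, ← hfy]
  constructor
  · rintro ⟨rfl, rfl⟩
    exact hf k l
  · intro h
    have := hf' k l (i, j) h
    exact ⟨congrArg Prod.fst this, congrArg Prod.snd this⟩

theorem SPermCode.disjointS_toMatrix_iff (p q : SPermCode) :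
    DisjointS 2 p.toMatrix q.toMatrix ↔ ∀ k l, ¬ (p.1 k = q.1 k ∧ p.2 l = q.2 l) := by
  simp only [DisjointS, SPermCode.toMatrix_eq_one_iff]
  constructor
  · rintro h k l ⟨hx, hy⟩
    exact h ⟨(k, p.1 k + l), (l, p.2 l + k), ⟨rfl, rfl⟩, by simp [hx], by simp [hy]⟩
  · rintro h ⟨r, c, ⟨h1, h2⟩, h3, h4⟩
    exact h r.1 c.1 ⟨add_right_cancel (h1.symm.trans h3), add_right_cancel (h2.symm.trans h4)⟩

/-- The graph on codes joining those whose matrices are disjoint. -/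
def SPermCode.disjointGraph : SimpleGraph SPermCode where
  Adj p q := ∀ k l, ¬ (p.1 k = q.1 k ∧ p.2 l = q.2 l)
  symm := ⟨fun _ _ h k l e => h k l ⟨e.1.symm, e.2.symm⟩⟩
  loopless := ⟨fun _ h => h 0 0 ⟨rfl, rfl⟩⟩

instance : DecidableRel SPermCode.disjointGraph.Adj := fun p q =>
  inferInstanceAs (Decidable (∀ k l, ¬ (p.1 k = q.1 k ∧ p.2 l = q.2 l)))

theorem SPermCode.card_edgeFinset_disjointGraph :
    SPermCode.disjointGraph.edgeFinset.card = 56 := by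
  have hdeg : ∀ p, SPermCode.disjointGraph.degree p = 7 := by decide +kernel
  have h := SPermCode.disjointGraph.sum_degrees_eq_twice_card_edges
  simp only [hdeg, Finset.sum_const, Finset.card_univ, smul_eq_mul] at h
  have hcard : Fintype.card SPermCode = 16 := by simp
  omega

/-- The number of unordered pairs of distinct disjoint `4 × 4` S-permutation
matrices is `56`. -/
theorem card_disjoint_pairs_two :
    Nat.card {s : Set ((Fin 2 × Fin 2) → (Fin 2 × Fin 2) → Fin 2) //
        ∃ A B, IsSPerm 2 A ∧ IsSPerm 2 B ∧ A ≠ B ∧ DisjointS 2 A B ∧ s = {A, B}} = 56 := by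
  let pair : Sym2 SPermCode → Set ((Fin 2 × Fin 2) → (Fin 2 × Fin 2) → Fin 2) :=
    fun e => SPermCode.toMatrix '' (e : Set SPermCode)
  have pair_injective : Function.Injective pair :=
    SPermCode.toMatrix_injective.image_injective.comp SetLike.coe_injective
  have pair_mk (p q : SPermCode) : pair s(p, q) = {p.toMatrix, q.toMatrix} := by
    simp [pair, Sym2.coe_mk, Set.image_pair]
  have hset : {s : Set ((Fin 2 × Fin 2) → (Fin 2 × Fin 2) → Fin 2) |
      ∃ A B, IsSPerm 2 A ∧ IsSPerm 2 B ∧ A ≠ B ∧ DisjointS 2 A B ∧ s = {A, B}} =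
      pair '' SPermCode.disjointGraph.edgeSet := by
    ext s
    constructor
    · rintro ⟨A, B, hA, hB, -, hAB, rfl⟩
      obtain ⟨p, rfl⟩ := hA.exists_toMatrix_eq
      obtain ⟨q, rfl⟩ := hB.exists_toMatrix_eq
      exact ⟨s(p, q), (p.disjointS_toMatrix_iff q).1 hAB, pair_mk p q⟩
    · rintro ⟨e, he, rfl⟩
      induction e with
      | _ p q =>
        have hpq : SPermCode.disjointGraph.Adj p q := he
        exact ⟨p.toMatrix, q.toMatrix, p.isSPerm_toMatrix, q.isSPerm_toMatrix,
          SPermCode.toMatrix_injective.ne hpq.ne, (p.disjointS_toMatrix_iff q).2 hpq, pair_mk p q⟩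
  change Set.ncard {s : Set ((Fin 2 × Fin 2) → (Fin 2 × Fin 2) → Fin 2) |
      ∃ A B, IsSPerm 2 A ∧ IsSPerm 2 B ∧ A ≠ B ∧ DisjointS 2 A B ∧ s = {A, B}} = 56
  rw [hset, Set.ncard_image_of_injective _ pair_injective, ← SimpleGraph.coe_edgeFinset,
    Set.ncard_coe_finset, SPermCode.card_edgeFinset_disjointGraph]
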